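/- Let t ≥ 1, n ≥ 2t+1, and let 𝓕 ⊆ 2^[n] be a set system of VC-dimension exactly t such that the projection 𝓕|_X = {F ∩ X : F ∈ 𝓕} is s-extremal for every (2t+1)-element subset X ⊆ [n]. Define 𝓖 = { H ⊆ [n] : H ∩ X ∈ 𝓕|_X for every X ⊆ [n] with |X| = 2t+1 }. Then 𝓕 ⊆ 𝓖, 𝓖 is s-extremal, and the VC-dimension of 𝓖 equals t. Moreover, if 𝓕 itself is s-extremal, then 𝓖 = 𝓕. -/

import Mathlib

open Finset

/-- The family of subsets of `[n]` (identified with `Fin n`) shattered by the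
set system `F ⊆ 2^[n]`. -/
def Sh (n : ℕ) (F : Finset (Finset (Fin n))) : Finset (Finset (Fin n)) :=
  Finset.univ.filter (fun S => ∀ H ∈ S.powerset, ∃ A ∈ F, A ∩ S = H)

/-- A set system is shattering-extremal (s-extremal) if it shatters exactly
`|F|` sets. -/
def SExtremal (n : ℕ) (F : Finset (Finset (Fin n))) : Prop :=
  (Sh n F).card = F.card

/-- The inclusion graph of a set system: vertices are the members of `F`,
two sets adjacent iff their symmetric difference is a single element. -/
def inclGraph (n : ℕ) (F : Finset (Finset (Fin n))) : SimpleGraph {A // A ∈ F} where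
  Adj A B := (symmDiff A.1 B.1).card = 1
  symm := by constructor; intro A B h; rwa [symmDiff_comm]
  loopless := by constructor; intro A h; simp [symmDiff_self] at h

section LocalSystems

variable {α : Type*} [DecidableEq α] {𝒜 : Finset (Finset α)} {a : α}

/-- The sets `B ∌ a` such that both `B` and `B ∪ {a}` belong to `𝒜`. -/
def familyLink (a : α) (𝒜 : Finset (Finset α)) : Finset (Finset α) :=
  𝒜.memberSubfamily a ∩ 𝒜.nonMemberSubfamily a

lemma mem_familyLink {B : Finset α} :
    B ∈ familyLink a 𝒜 ↔ a ∉ B ∧ B ∈ 𝒜 ∧ insert a B ∈ 𝒜 := by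
  simp only [familyLink, mem_inter, mem_memberSubfamily, mem_nonMemberSubfamily]
  tauto

lemma card_image_erase_add_card_familyLink (a : α) (𝒜 : Finset (Finset α)) :
    #(𝒜.image fun A => A.erase a) + #(familyLink a 𝒜) = #𝒜 := by
  rw [← memberSubfamily_union_nonMemberSubfamily, familyLink, card_union_add_card_inter,
    card_memberSubfamily_add_card_nonMemberSubfamily]

lemma shatters_image_inter {Y T : Finset α} :
    (𝒜.image (· ∩ Y)).Shatters T ↔ T ⊆ Y ∧ 𝒜.Shatters T := by
  constructor
  · intro h
    have hTY : T ⊆ Y := by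
      obtain ⟨u, hu, hTu⟩ := h.exists_superset
      obtain ⟨A, -, rfl⟩ := mem_image.1 hu
      exact hTu.trans inter_subset_right
    refine ⟨hTY, fun H hH => ?_⟩
    obtain ⟨u, hu, hTu⟩ := h hH
    obtain ⟨A, hA, rfl⟩ := mem_image.1 hu
    refine ⟨A, hA, ?_⟩
    rw [← hTu]
    grind
  · rintro ⟨hTY, h⟩ H hH
    obtain ⟨A, hA, hTA⟩ := h hH
    refine ⟨A ∩ Y, mem_image_of_mem _ hA, ?_⟩
    rw [← hTA]
    grind

lemma shatters_image_erase {T : Finset α} :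
    (𝒜.image fun A => A.erase a).Shatters T ↔ a ∉ T ∧ 𝒜.Shatters T := by
  constructor
  · intro h
    have haT : a ∉ T := by
      obtain ⟨u, hu, hTu⟩ := h.exists_superset
      obtain ⟨A, -, rfl⟩ := mem_image.1 hu
      exact fun ha => notMem_erase a A (hTu ha)
    refine ⟨haT, fun H hH => ?_⟩
    obtain ⟨u, hu, hTu⟩ := h hH
    obtain ⟨A, hA, rfl⟩ := mem_image.1 hu
    refine ⟨A, hA, ?_⟩
    rw [← hTu]
    grind
  · rintro ⟨haT, h⟩ H hH
    obtain ⟨A, hA, hTA⟩ := h hH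
    refine ⟨A.erase a, mem_image_of_mem _ hA, ?_⟩
    rw [← hTA]
    grind

lemma notMem_of_shatters_familyLink {T : Finset α} (h : (familyLink a 𝒜).Shatters T) :
    a ∉ T := by
  obtain ⟨u, hu, hTu⟩ := h.exists_superset
  exact fun ha => (mem_familyLink.1 hu).1 (hTu ha)

lemma shatters_insert_of_shatters_familyLink {T : Finset α}
    (h : (familyLink a 𝒜).Shatters T) : 𝒜.Shatters (insert a T) := by
  have haT := notMem_of_shatters_familyLink h
  intro H hH
  obtain ⟨u, hu, hTu⟩ := h (t := H.erase a) (by grind)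
  obtain ⟨hau, hu0, hu1⟩ := mem_familyLink.1 hu
  by_cases ha : a ∈ H
  · refine ⟨insert a u, hu1, ?_⟩
    rw [← insert_inter_distrib, hTu, insert_erase ha]
  · refine ⟨u, hu0, ?_⟩
    rw [insert_inter_of_notMem hau, hTu, erase_eq_of_notMem ha]

/-- Splitting an extremal family along one coordinate: the projection and the link are
extremal, and the link shatters everything it possibly can. -/
lemma extremal_split (a : α) (h : #𝒜.shatterer ≤ #𝒜) :
    #(𝒜.image fun A => A.erase a).shatterer ≤ #(𝒜.image fun A => A.erase a) ∧
    #(familyLink a 𝒜).shatterer ≤ #(familyLink a 𝒜) ∧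
    ∀ T, a ∉ T → 𝒜.Shatters (insert a T) → (familyLink a 𝒜).Shatters T := by
  have hsplit := card_image_erase_add_card_familyLink a 𝒜
  have hP := card_le_card_shatterer (𝒜.image fun A => A.erase a)
  have hL := card_le_card_shatterer (familyLink a 𝒜)
  have hS := card_filter_add_card_filter_not (s := 𝒜.shatterer) (fun T => a ∉ T)
  have hSP : (𝒜.shatterer.filter fun T => a ∉ T) =
      (𝒜.image fun A => A.erase a).shatterer := by
    ext T
    simp [shatters_image_erase, and_comm]
  have hinj : Set.InjOn (insert a) ((familyLink a 𝒜).shatterer : Set (Finset α)) := by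
    intro T hT U hU hTU
    have hT' := notMem_of_shatters_familyLink (mem_shatterer.1 hT)
    have hU' := notMem_of_shatters_familyLink (mem_shatterer.1 hU)
    rw [← erase_insert hT', ← erase_insert hU', hTU]
  have hcard := card_image_of_injOn hinj
  have hsub : (familyLink a 𝒜).shatterer.image (insert a) ⊆
      𝒜.shatterer.filter fun T => ¬ a ∉ T := by
    intro T hT
    obtain ⟨U, hU, rfl⟩ := mem_image.1 hT
    simpa using shatters_insert_of_shatters_familyLink (mem_shatterer.1 hU)
  have hle := card_le_card hsub
  rw [hSP] at hS
  refine ⟨by omega, by omega, fun T haT hT => ?_⟩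
  have heq := eq_of_subset_of_card_le hsub (by omega)
  have hmem : insert a T ∈ 𝒜.shatterer.filter fun T => ¬ a ∉ T := by simpa using hT
  rw [← heq] at hmem
  obtain ⟨U, hU, hUT⟩ := mem_image.1 hmem
  have hU' := notMem_of_shatters_familyLink (mem_shatterer.1 hU)
  rw [← erase_insert haT, ← hUT, erase_insert hU']
  exact mem_shatterer.1 hU

lemma extremal_image_sdiff (Z : Finset α) (h : #𝒜.shatterer ≤ #𝒜) :
    #(𝒜.image (· \ Z)).shatterer ≤ #(𝒜.image (· \ Z)) := by
  induction Z using Finset.induction_on with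
  | empty => simpa using h
  | insert a Z _ ih =>
    have heq : 𝒜.image (· \ insert a Z) = (𝒜.image (· \ Z)).image fun A => A.erase a := by
      rw [image_image]
      refine image_congr fun A _ => ?_
      simp [sdiff_insert]
    rw [heq]
    exact (extremal_split a ih).1

lemma extremal_image_inter [Fintype α] (Y : Finset α) (h : #𝒜.shatterer ≤ #𝒜) :
    #(𝒜.image (· ∩ Y)).shatterer ≤ #(𝒜.image (· ∩ Y)) := by
  have heq : 𝒜.image (· ∩ Y) = 𝒜.image (· \ Yᶜ) :=
    image_congr fun A _ => by simp
  rw [heq]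
  exact extremal_image_sdiff _ h

/-- An extremal family shattering only sets with fewer than `s` elements is determined by
its traces on sets with at most `s` elements. -/
lemma exists_small_trace_notMem {s : ℕ} {B : Finset α} (h : #𝒜.shatterer ≤ #𝒜)
    (hs : ∀ T, 𝒜.Shatters T → #T < s) (hB : B ∉ 𝒜) :
    ∃ S, #S ≤ s ∧ (insert B 𝒜).Shatters S ∧ B ∩ S ∉ 𝒜.image (· ∩ S) := by
  have hcard := card_le_card_shatterer (insert B 𝒜)
  rw [card_insert_of_notMem hB] at hcard
  obtain ⟨S₀, hS₀, hS₀'⟩ := exists_mem_notMem_of_card_lt_card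
    (show #𝒜.shatterer < #(insert B 𝒜).shatterer by omega)
  have hne : (S₀.powerset.filter fun S => ¬ 𝒜.Shatters S).Nonempty :=
    ⟨S₀, by simpa using hS₀'⟩
  obtain ⟨S, hS, hmin⟩ := exists_min_image _ card hne
  simp only [mem_filter, mem_powerset] at hS hmin
  have hSsh : (insert B 𝒜).Shatters S := (mem_shatterer.1 hS₀).mono_right hS.1
  refine ⟨S, ?_, hSsh, ?_⟩
  · obtain rfl | ⟨x, hx⟩ := S.eq_empty_or_nonempty
    · simp
    · have hsh : 𝒜.Shatters (S.erase x) := by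
        by_contra hcon
        have := hmin _ ⟨(erase_subset _ _).trans hS.1, hcon⟩
        have := card_erase_lt_of_mem hx
        omega
      have := hs _ hsh
      have := card_erase_of_mem hx
      omega
  · intro hmem
    obtain ⟨A, hA, hAS⟩ := mem_image.1 hmem
    refine hS.2 fun H hH => ?_
    obtain ⟨u, hu, hSu⟩ := hSsh hH
    obtain rfl | hu := mem_insert.1 hu
    · exact ⟨A, hA, by rw [inter_comm, hAS, inter_comm, hSu]⟩
    · exact ⟨u, hu, hSu⟩

/-- A compatible system of extremal families `𝓕 X` on the subsets `X` of `V` with at most `m`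
elements, all of whose shattered sets have fewer than `s` elements. -/
structure IsLocalSystem (V : Finset α) (m s : ℕ) (𝓕 : Finset α → Finset (Finset α)) :
    Prop where
  trace : ∀ X ⊆ V, #X ≤ m → ∀ Y ⊆ X, 𝓕 Y = (𝓕 X).image (· ∩ Y)
  extremal : ∀ X ⊆ V, #X ≤ m → #(𝓕 X).shatterer ≤ #(𝓕 X)
  card_lt : ∀ X ⊆ V, #X ≤ m → ∀ T, (𝓕 X).Shatters T → #T < s

/-- The sets whose traces on the small sets belong to the local system. -/
def globalSections (V : Finset α) (m : ℕ) (𝓕 : Finset α → Finset (Finset α)) :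
    Finset (Finset α) :=
  V.powerset.filter fun B => ∀ X ⊆ V, #X ≤ m → B ∩ X ∈ 𝓕 X

/-- The small sets that are shattered by the local system. -/
def localShatterer (V : Finset α) (m : ℕ) (𝓕 : Finset α → Finset (Finset α)) :
    Finset (Finset α) :=
  V.powerset.filter fun T => #T ≤ m ∧ (𝓕 T).Shatters T

lemma mem_globalSections {V B : Finset α} {m : ℕ} {𝓕 : Finset α → Finset (Finset α)} :
    B ∈ globalSections V m 𝓕 ↔ B ⊆ V ∧ ∀ X ⊆ V, #X ≤ m → B ∩ X ∈ 𝓕 X := by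
  simp [globalSections]

lemma mem_localShatterer {V T : Finset α} {m : ℕ} {𝓕 : Finset α → Finset (Finset α)} :
    T ∈ localShatterer V m 𝓕 ↔ T ⊆ V ∧ #T ≤ m ∧ (𝓕 T).Shatters T := by
  simp [localShatterer]

namespace IsLocalSystem

variable {V : Finset α} {m s : ℕ} {𝓕 : Finset α → Finset (Finset α)}

lemma mono {W : Finset α} (h : IsLocalSystem V m s 𝓕) (hWV : W ⊆ V) :
    IsLocalSystem W m s 𝓕 where
  trace X hX := h.trace X (hX.trans hWV)
  extremal X hX := h.extremal X (hX.trans hWV)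
  card_lt X hX := h.card_lt X (hX.trans hWV)

lemma subset_of_mem {X B : Finset α} (h : IsLocalSystem V m s 𝓕) (hX : X ⊆ V) (hXm : #X ≤ m)
    (hB : B ∈ 𝓕 X) : B ⊆ X := by
  rw [h.trace X hX hXm X Subset.rfl] at hB
  obtain ⟨A, -, rfl⟩ := mem_image.1 hB
  exact inter_subset_right

lemma inter_mem {X Y B : Finset α} (h : IsLocalSystem V m s 𝓕) (hX : X ⊆ V) (hXm : #X ≤ m)
    (hYX : Y ⊆ X) (hB : B ∩ X ∈ 𝓕 X) : B ∩ Y ∈ 𝓕 Y := by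
  rw [h.trace X hX hXm Y hYX]
  refine mem_image.2 ⟨B ∩ X, hB, ?_⟩
  simp only [inter_assoc, inter_eq_right.2 hYX]

lemma exists_of_notMem {B : Finset α} (h : IsLocalSystem V m s 𝓕) (hBV : B ⊆ V)
    (hB : B ∉ globalSections V m 𝓕) : ∃ S ⊆ V, #S ≤ s ∧ B ∩ S ∉ 𝓕 S := by
  simp only [mem_globalSections, hBV, true_and, not_forall] at hB
  obtain ⟨X, hX, hXm, hBX⟩ := hB
  obtain ⟨S, hSs, hS, hBS⟩ :=
    exists_small_trace_notMem (h.extremal X hX hXm) (h.card_lt X hX hXm) hBX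
  have hSX : S ⊆ X := by
    obtain ⟨u, hu, hSu⟩ := hS.exists_superset
    obtain rfl | hu := mem_insert.1 hu
    · exact hSu.trans inter_subset_right
    · exact hSu.trans (h.subset_of_mem hX hXm hu)
  refine ⟨S, hSX.trans hX, hSs, ?_⟩
  rwa [h.trace X hX hXm S hSX, ← inter_eq_right.2 hSX, ← inter_assoc, inter_eq_right.2 hSX]

/-- Every global section over `V` extends to `V ∪ {a}`. -/
lemma globalSections_subset_image_erase (h : IsLocalSystem (insert a V) m s 𝓕) (ha : a ∉ V)
    (hsm : 2 * s ≤ m + 1) : globalSections V m 𝓕 ⊆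
      (globalSections (insert a V) m 𝓕).image fun A => A.erase a := by
  intro B hB
  obtain ⟨hBV, hBX⟩ := mem_globalSections.1 hB
  have haB : a ∉ B := fun h => ha (hBV h)
  by_contra hcon
  have h0 : B ∉ globalSections (insert a V) m 𝓕 := fun hmem =>
    hcon (mem_image.2 ⟨B, hmem, erase_eq_of_notMem haB⟩)
  have h1 : insert a B ∉ globalSections (insert a V) m 𝓕 := fun hmem =>
    hcon (mem_image.2 ⟨_, hmem, erase_insert haB⟩)
  obtain ⟨S, hSV, hSs, hBS⟩ := h.exists_of_notMem (hBV.trans (subset_insert _ _)) h0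
  obtain ⟨S', hSV', hSs', hBS'⟩ := h.exists_of_notMem (insert_subset_insert a hBV) h1
  have haS : a ∈ S := by
    by_contra haS
    exact hBS (hBX S ((subset_insert_iff_of_notMem haS).1 hSV) (by omega))
  have haS' : a ∈ S' := by
    by_contra haS'
    rw [insert_inter_of_notMem haS'] at hBS'
    exact hBS' (hBX S' ((subset_insert_iff_of_notMem haS').1 hSV') (by omega))
  have hUcard : #(S ∪ S') ≤ m := by
    have h2 := card_union_add_card_inter S S'
    have h3 : 0 < #(S ∩ S') := card_pos.2 ⟨a, mem_inter.2 ⟨haS, haS'⟩⟩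
    omega
  have hUV : S ∪ S' ⊆ insert a V := union_subset hSV hSV'
  have hmem := hBX ((S ∪ S').erase a) (subset_insert_iff.1 hUV)
    ((card_le_card (erase_subset _ _)).trans hUcard)
  rw [h.trace _ hUV hUcard _ (erase_subset _ _)] at hmem
  obtain ⟨C, hC, hCB⟩ := mem_image.1 hmem
  have hCU := h.subset_of_mem hUV hUcard hC
  simp only [inter_erase] at hCB
  by_cases haC : a ∈ C
  · refine hBS' (h.inter_mem hUV hUcard subset_union_right ?_)
    convert hC using 1
    rw [inter_eq_left.2 hCU] at hCB
    rw [insert_inter_of_mem (mem_union_left _ haS), ← insert_erase haC, hCB, erase_eq_of_notMem]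
    exact fun h => haB (mem_inter.1 h).1
  · refine hBS (h.inter_mem hUV hUcard subset_union_left ?_)
    convert hC using 1
    rw [inter_eq_left.2 hCU, erase_eq_of_notMem haC, erase_eq_of_notMem] at hCB
    · exact hCB.symm
    · exact fun h => haB (mem_inter.1 h).1

lemma link [Fintype α] (h : IsLocalSystem (insert a V) (m + 1) (s + 1) 𝓕) (ha : a ∉ V) :
    IsLocalSystem V m s fun X => familyLink a (𝓕 (insert a X)) where
  trace X hX hXm Y hYX := by
    have hX' := insert_subset_insert a hX
    have hXm' : #(insert a X) ≤ m + 1 := (card_insert_le _ _).trans (by omega)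
    have htr := h.trace _ hX' hXm' _ (insert_subset_insert a hYX)
    have hspl := extremal_split a (h.extremal _ hX' hXm')
    have haY : a ∉ Y := fun h => ha (hX (hYX h))
    symm
    apply eq_of_subset_of_card_le
    · intro B hB
      obtain ⟨A, hA, rfl⟩ := mem_image.1 hB
      obtain ⟨haA, hA0, hA1⟩ := mem_familyLink.1 hA
      refine mem_familyLink.2 ⟨fun h => haA (mem_inter.1 h).1, ?_, ?_⟩
      · rw [htr]
        exact mem_image.2 ⟨A, hA0, inter_insert_of_notMem haA⟩
      · rw [htr]
        exact mem_image.2 ⟨_, hA1, (insert_inter_distrib _ _ _).symm⟩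
    · refine (card_le_card_shatterer _).trans
        (le_trans (card_le_card fun T hT => ?_) (extremal_image_inter Y hspl.2.1))
      rw [mem_shatterer] at hT ⊢
      have haT := notMem_of_shatters_familyLink hT
      have hT' := shatters_insert_of_shatters_familyLink hT
      rw [htr, shatters_image_inter] at hT'
      exact shatters_image_inter.2
        ⟨(insert_subset_insert_iff haT).1 hT'.1, hspl.2.2 T haT hT'.2⟩
  extremal X hX hXm := (extremal_split a (h.extremal _ (insert_subset_insert a hX)
    ((card_insert_le _ _).trans (by omega)))).2.1
  card_lt X hX hXm T hT := by
    have h1 := h.card_lt _ (insert_subset_insert a hX)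
      ((card_insert_le _ _).trans (by omega)) _ (shatters_insert_of_shatters_familyLink hT)
    rw [card_insert_of_notMem (notMem_of_shatters_familyLink hT)] at h1
    omega

lemma globalSections_link_subset (h : IsLocalSystem (insert a V) (m + 1) s 𝓕) (ha : a ∉ V)
    (hsm : s ≤ m) : globalSections V m (fun X => familyLink a (𝓕 (insert a X))) ⊆
      familyLink a (globalSections (insert a V) (m + 1) 𝓕) := by
  intro B hB
  obtain ⟨hBV, hBX⟩ := mem_globalSections.1 hB
  have haB : a ∉ B := fun h => ha (hBV h)
  have key : ∀ S ⊆ insert a V, #S ≤ s → B ∩ S ∈ 𝓕 S ∧ insert a B ∩ S ∈ 𝓕 S := by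
    intro S hS hSs
    have hSV := subset_insert_iff.1 hS
    have hcard : #(S.erase a) ≤ m := (card_le_card (erase_subset _ _)).trans (hSs.trans hsm)
    obtain ⟨-, h0, h1⟩ := mem_familyLink.1 (hBX _ hSV hcard)
    have hU := insert_subset_insert a hSV
    have hUm : #(insert a (S.erase a)) ≤ m + 1 := (card_insert_le _ _).trans (by omega)
    have hSU : S ⊆ insert a (S.erase a) := subset_insert_iff.2 Subset.rfl
    refine ⟨h.inter_mem hU hUm hSU ?_, h.inter_mem hU hUm hSU ?_⟩
    · rwa [inter_insert_of_notMem haB]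
    · rwa [← insert_inter_distrib]
  refine mem_familyLink.2 ⟨haB, ?_, ?_⟩
  · by_contra hcon
    obtain ⟨S, hS, hSs, hBS⟩ := h.exists_of_notMem (hBV.trans (subset_insert _ _)) hcon
    exact hBS (key S hS hSs).1
  · by_contra hcon
    obtain ⟨S, hS, hSs, hBS⟩ := h.exists_of_notMem (insert_subset_insert a hBV) hcon
    exact hBS (key S hS hSs).2

lemma card_localShatterer_insert_le (h : IsLocalSystem (insert a V) (m + 1) s 𝓕) :
    #(localShatterer (insert a V) (m + 1) 𝓕) ≤ #(localShatterer V (m + 1) 𝓕) +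
      #(localShatterer V m fun X => familyLink a (𝓕 (insert a X))) := by
  refine (card_le_card (t := localShatterer V (m + 1) 𝓕 ∪
    (localShatterer V m fun X => familyLink a (𝓕 (insert a X))).image (insert a)) ?_).trans
    ((card_union_le _ _).trans (Nat.add_le_add_left card_image_le _))
  intro T hT
  obtain ⟨hTV, hTm, hTs⟩ := mem_localShatterer.1 hT
  by_cases haT : a ∈ T
  · refine mem_union_right _ (mem_image.2 ⟨T.erase a, ?_, insert_erase haT⟩)
    refine mem_localShatterer.2 ⟨subset_insert_iff.1 hTV, ?_, ?_⟩
    · rw [card_erase_of_mem haT]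
      omega
    · rw [insert_erase haT]
      refine (extremal_split a (h.extremal T hTV hTm)).2.2 _ (notMem_erase a T) ?_
      rwa [insert_erase haT]
  · exact mem_union_left _
      (mem_localShatterer.2 ⟨(subset_insert_iff_of_notMem haT).1 hTV, hTm, hTs⟩)

/-- A local system has at least as many global sections as shattered sets. -/
theorem card_localShatterer_le [Fintype α] (h : IsLocalSystem V m s 𝓕)
    (hsm : 2 * s ≤ m + 1) : #(localShatterer V m 𝓕) ≤ #(globalSections V m 𝓕) := by
  induction V using Finset.induction_on generalizing m s 𝓕 with
  | empty =>
    refine card_le_card fun T hT => ?_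
    obtain ⟨hT0, -, hTs⟩ := mem_localShatterer.1 hT
    obtain rfl := subset_empty.1 hT0
    refine mem_globalSections.2 ⟨Subset.rfl, fun X hX _ => ?_⟩
    obtain rfl := subset_empty.1 hX
    obtain ⟨u, hu⟩ := hTs.nonempty
    obtain rfl := subset_empty.1 (h.subset_of_mem Subset.rfl (by simp) hu)
    simpa using hu
  | insert a V ha ih =>
    obtain _ | s := s
    · have hempty : localShatterer (insert a V) m 𝓕 = ∅ := by
        refine eq_empty_of_forall_notMem fun T hT => ?_
        obtain ⟨hTV, hTm, hTs⟩ := mem_localShatterer.1 hT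
        exact absurd (h.card_lt T hTV hTm T hTs) (by omega)
      simp [hempty]
    obtain _ | m := m
    · omega
    have hproj := (ih (h.mono (subset_insert a V)) hsm).trans
      (card_le_card (h.globalSections_subset_image_erase ha hsm))
    have hlink : #(localShatterer V m fun X => familyLink a (𝓕 (insert a X))) ≤
        #(familyLink a (globalSections (insert a V) (m + 1) 𝓕)) := by
      obtain _ | s := s
      · have hempty : (localShatterer V m fun X => familyLink a (𝓕 (insert a X))) = ∅ := by
          refine eq_empty_of_forall_notMem fun T hT => ?_
          obtain ⟨hTV, hTm, hTs⟩ := mem_localShatterer.1 hT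
          exact absurd ((h.link ha).card_lt T hTV hTm T hTs) (by omega)
        simp [hempty]
      · exact (ih (h.link ha) (by omega)).trans
          (card_le_card (h.globalSections_link_subset ha (by omega)))
    have hcount := h.card_localShatterer_insert_le
    have hsplit := card_image_erase_add_card_familyLink a (globalSections (insert a V) (m + 1) 𝓕)
    omega

end IsLocalSystem

end LocalSystems

lemma Sh_eq_shatterer (n : ℕ) (F : Finset (Finset (Fin n))) : Sh n F = F.shatterer := by
  ext S
  simp [Sh, Finset.Shatters, inter_comm S]

/-- If `F` has VC-dimension exactly `t ≥ 1` and all its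
projections to `(2t+1)`-element sets are s-extremal, then the system `G` of
all sets whose trace on every `(2t+1)`-element set lies in the corresponding
projection contains `F`, is s-extremal, and has VC-dimension exactly `t`;
moreover if `F` is s-extremal then `G = F`. -/
theorem stmt16 (n t : ℕ) (ht : 1 ≤ t) (hn : 2 * t + 1 ≤ n)
    (F : Finset (Finset (Fin n)))
    (hVCle : ∀ S ∈ Sh n F, S.card ≤ t) (hVCeq : ∃ S ∈ Sh n F, S.card = t)
    (hproj : ∀ X : Finset (Fin n), X.card = 2 * t + 1 →
      SExtremal n (F.image (fun A => A ∩ X)))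
    (G : Finset (Finset (Fin n)))
    (hG : ∀ H : Finset (Fin n), H ∈ G ↔
      ∀ X : Finset (Fin n), X.card = 2 * t + 1 →
        H ∩ X ∈ F.image (fun A => A ∩ X)) :
    F ⊆ G ∧ SExtremal n G ∧
      (∀ S ∈ Sh n G, S.card ≤ t) ∧ (∃ S ∈ Sh n G, S.card = t) ∧
      (SExtremal n F → G = F) := by
  simp only [SExtremal, Sh_eq_shatterer, mem_shatterer] at *
  have hFG : F ⊆ G := fun A hA => (hG A).2 fun X _ => mem_image_of_mem _ hA
  have hext : ∀ X : Finset (Fin n), #X ≤ 2 * t + 1 →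
      ∃ Y, X ⊆ Y ∧ #Y = 2 * t + 1 := fun X hX => by
    obtain ⟨Y, hXY, -, hY⟩ := exists_subsuperset_card_eq (subset_univ X) hX (by simpa using hn)
    exact ⟨Y, hXY, hY⟩
  have htrace : ∀ X Y : Finset (Fin n), Y ⊆ X →
      F.image (· ∩ Y) = (F.image (· ∩ X)).image (· ∩ Y) := fun X Y hYX => by
    rw [image_image]
    refine image_congr fun A _ => ?_
    simp [inter_assoc, inter_eq_right.2 hYX]
  have hsmall : ∀ T, #T ≤ 2 * t + 1 → G.Shatters T → F.Shatters T := fun T hT hGT => by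
    obtain ⟨X, hTX, hX⟩ := hext T hT
    have hsub : G.image (· ∩ X) ⊆ F.image (· ∩ X) := by
      intro B hB
      obtain ⟨A, hA, rfl⟩ := mem_image.1 hB
      exact (hG A).1 hA X hX
    exact (shatters_image_inter.1 ((shatters_image_inter.2 ⟨hTX, hGT⟩).mono_left hsub)).2
  have hGle : ∀ S, G.Shatters S → #S ≤ t := fun S hS => by
    by_contra! hcon
    obtain ⟨T, hTS, hT⟩ := exists_subset_card_eq (show t + 1 ≤ #S by omega)
    have := hVCle T (hsmall T (by omega) (hS.mono_right hTS))
    omega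
  have hsh : G.shatterer ⊆ F.shatterer := fun S hS => by
    rw [mem_shatterer] at hS ⊢
    exact hsmall S (by have := hGle S hS; omega) hS
  have hsys : IsLocalSystem univ (2 * t + 1) (t + 1) fun X => F.image (· ∩ X) := by
    refine ⟨fun X _ _ Y => htrace X Y, fun X _ hX => ?_, fun X _ _ T hT => ?_⟩
    · obtain ⟨Y, hXY, hY⟩ := hext X hX
      simp only [htrace Y X hXY]
      exact extremal_image_inter X (hproj Y hY).le
    · exact Nat.lt_succ_of_le (hVCle T (shatters_image_inter.1 hT).2)
  have hle : #G.shatterer ≤ #G := by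
    refine (card_le_card fun S hS => ?_).trans
      ((hsys.card_localShatterer_le (by omega)).trans (card_le_card fun B hB => ?_))
    · have hS' := mem_shatterer.1 hS
      exact mem_localShatterer.2 ⟨subset_univ S, by have := hGle S hS'; omega,
        shatters_image_inter.2 ⟨Subset.rfl, mem_shatterer.1 (hsh hS)⟩⟩
    · exact (hG B).2 fun X hX => (mem_globalSections.1 hB).2 X (subset_univ X) hX.le
  refine ⟨hFG, hle.antisymm (card_le_card_shatterer G), hGle, ?_, fun hF => ?_⟩
  · obtain ⟨S, hS, hSt⟩ := hVCeq
    exact ⟨S, hS.mono_left hFG, hSt⟩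
  · refine (eq_of_subset_of_card_le hFG ?_).symm
    exact (card_le_card_shatterer G).trans ((card_le_card hsh).trans hF.le)
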